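/- Let ε ∈ (0, 1/30) and define P(t) := f(t²−1) − ε(t−1)⁵ for t > 0, where f(x) := π + (1/2)(4+π)x − 2(x+2)·arctan(√(x+1)). Then there exists a real number η > 0 such that 2t·ln t ≤ P(t) ≤ f(t²−1) for all t ∈ [1, 1+η] and 2t·ln t ≥ P(t) ≥ f(t²−1) for all t ∈ [1−η, 1]. -/

import Mathlib

open Real Set

noncomputable def f (x : ℝ) : ℝ :=
  π + (1 / 2) * (4 + π) * x - 2 * (x + 2) * Real.arctan (Real.sqrt (x + 1))

theorem monotoneOn_Icc_of_hasDerivAt_nonneg {g g' : ℝ → ℝ} {a b : ℝ}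
    (hg : ∀ t ∈ Icc a b, HasDerivAt g (g' t) t) (h : ∀ t ∈ Icc a b, 0 ≤ g' t) :
    MonotoneOn g (Icc a b) := by
  refine monotoneOn_of_deriv_nonneg (convex_Icc a b)
    (fun t ht => (hg t ht).continuousAt.continuousWithinAt)
    (fun t ht => (hg t (interior_subset ht)).differentiableAt.differentiableWithinAt)
    (fun t ht => ?_)
  rw [(hg t (interior_subset ht)).deriv]
  exact h t (interior_subset ht)

theorem monotoneOn_of_third_deriv_nonneg {g g₁ g₂ g₃ : ℝ → ℝ} {a b c : ℝ} (hc : c ∈ Icc a b)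
    (hg : ∀ t ∈ Icc a b, HasDerivAt g (g₁ t) t) (hg₁ : ∀ t ∈ Icc a b, HasDerivAt g₁ (g₂ t) t)
    (hg₂ : ∀ t ∈ Icc a b, HasDerivAt g₂ (g₃ t) t) (h : ∀ t ∈ Icc a b, 0 ≤ g₃ t)
    (h₁ : g₁ c = 0) (h₂ : g₂ c = 0) :
    MonotoneOn g (Icc a b) := by
  have hm₂ := monotoneOn_Icc_of_hasDerivAt_nonneg hg₂ h
  refine monotoneOn_Icc_of_hasDerivAt_nonneg hg fun t ht => ?_
  rcases le_total c t with hct | htc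
  · have hm₁ := monotoneOn_Icc_of_hasDerivAt_nonneg (a := c) (b := b)
      (fun s hs => hg₁ s ⟨hc.1.trans hs.1, hs.2⟩)
      (fun s hs => h₂ ▸ hm₂ hc ⟨hc.1.trans hs.1, hs.2⟩ hs.1)
    exact h₁ ▸ hm₁ ⟨le_rfl, hc.2⟩ ⟨hct, ht.2⟩ hct
  · have hm₁ := monotoneOn_Icc_of_hasDerivAt_nonneg (a := a) (b := c)
      (fun s hs => (hg₁ s ⟨hs.1, hs.2.trans hc.2⟩).neg)
      (fun s hs => neg_nonneg.2 (h₂ ▸ hm₂ ⟨hs.1, hs.2.trans hc.2⟩ hc hs.2))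
    have h_le := hm₁ ⟨ht.1, htc⟩ ⟨hc.1, le_rfl⟩ htc
    simp only [Pi.neg_apply, h₁] at h_le
    linarith

theorem f_sq_sub_one {t : ℝ} (ht : 0 < t) :
    f (t ^ 2 - 1) = π + (1 / 2) * (4 + π) * (t ^ 2 - 1) - 2 * (t ^ 2 + 1) * Real.arctan t := by
  rw [f, sub_add_cancel, Real.sqrt_sq ht.le]
  ring

theorem exists_monotoneOn_gap {ε : ℝ} (hε : ε < 1 / 30) :
    ∃ η : ℝ, 0 < η ∧ η < 1 ∧ MonotoneOn (fun t : ℝ => π + (1 / 2) * (4 + π) * (t ^ 2 - 1)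
      - 2 * (t ^ 2 + 1) * Real.arctan t - ε * (t - 1) ^ 5 - 2 * t * Real.log t)
      (Icc (1 - η) (1 + η)) := by
  have h_cont : ContinuousAt
      (fun t : ℝ => 2 * (t + 1) ^ 2 / (t ^ 2 * (1 + t ^ 2) ^ 2)) 1 := by
    refine ContinuousAt.div (by fun_prop) (by fun_prop) (by norm_num)
  have h_ev : ∀ᶠ t : ℝ in nhds 1, 60 * ε < 2 * (t + 1) ^ 2 / (t ^ 2 * (1 + t ^ 2) ^ 2) := by
    refine h_cont.eventually_const_lt ?_
    norm_num
    linarith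
  obtain ⟨δ, hδ, h_ball⟩ := Metric.eventually_nhds_iff.1 h_ev
  have hη : 0 < min (δ / 2) (1 / 2) := by positivity
  have hη₁ : min (δ / 2) (1 / 2) ≤ 1 / 2 := min_le_right _ _
  have hη₂ : min (δ / 2) (1 / 2) ≤ δ / 2 := min_le_left _ _
  refine ⟨min (δ / 2) (1 / 2), hη, by linarith, ?_⟩
  generalize min (δ / 2) (1 / 2) = η at *
  have h_pos : ∀ t ∈ Icc (1 - η) (1 + η), 0 < t := fun t ht => by linarith [ht.1]
  refine monotoneOn_of_third_deriv_nonneg (c := 1)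
    (g₁ := fun t => (4 + π) * t - 4 * t * Real.arctan t - 4 - 5 * ε * (t - 1) ^ 4
      - 2 * Real.log t)
    (g₂ := fun t => 4 + π - 4 * Real.arctan t - 4 * t / (1 + t ^ 2) - 20 * ε * (t - 1) ^ 3
      - 2 / t)
    (g₃ := fun t => (t - 1) ^ 2 * (2 * (t + 1) ^ 2 / (t ^ 2 * (1 + t ^ 2) ^ 2) - 60 * ε))
    ⟨by linarith, by linarith⟩ (fun t ht => ?_) (fun t ht => ?_) (fun t ht => ?_)
    (fun t ht => ?_) (by norm_num [Real.arctan_one]; ring) (by norm_num [Real.arctan_one]; ring)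
  · have ht₀ := h_pos t ht
    have h_id := hasDerivAt_id' t
    have h_at := Real.hasDerivAt_arctan t
    refine HasDerivAt.congr_deriv
      (((((((h_id.pow 2).sub_const 1).const_mul ((1 / 2) * (4 + π))).const_add
        π).sub
      ((((h_id.pow 2).add_const 1).const_mul 2).mul h_at)).sub
      (((h_id.sub_const 1).pow 5).const_mul ε)).sub
      ((h_id.const_mul 2).mul (Real.hasDerivAt_log ht₀.ne'))) ?_
    simp only [Pi.pow_apply]
    field_simp
    ring
  · have ht₀ := h_pos t ht
    have h_id := hasDerivAt_id' t
    have h_at := Real.hasDerivAt_arctan t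
    refine HasDerivAt.congr_deriv
      (((((h_id.const_mul (4 + π)).sub ((h_id.const_mul 4).mul h_at)).sub_const 4).sub
      (((h_id.sub_const 1).pow 4).const_mul (5 * ε))).sub
      ((Real.hasDerivAt_log ht₀.ne').const_mul 2)) ?_
    field_simp
    ring
  · have ht₀ := h_pos t ht
    have h_id := hasDerivAt_id' t
    have h_at := Real.hasDerivAt_arctan t
    refine HasDerivAt.congr_deriv
      (((((h_at.const_mul 4).const_sub (4 + π)).sub
      ((h_id.const_mul 4).div ((h_id.pow 2).const_add 1)
        (show (1 + t ^ 2 : ℝ) ≠ 0 by positivity))).sub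
      (((h_id.sub_const 1).pow 3).const_mul (20 * ε))).sub
      ((hasDerivAt_const t (2 : ℝ)).div h_id ht₀.ne')) ?_
    simp only [Pi.pow_apply]
    field_simp
    ring
  · refine mul_nonneg (sq_nonneg _) (sub_nonneg.2 (h_ball ?_).le)
    rw [Real.dist_eq, abs_lt]
    constructor <;> linarith [ht.1, ht.2]

theorem refined_local_bounds (ε : ℝ) (hε : ε ∈ Set.Ioo (0 : ℝ) (1 / 30))
    (P : ℝ → ℝ) (hP : ∀ t : ℝ, 0 < t → P t = f (t ^ 2 - 1) - ε * (t - 1) ^ 5) :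
    ∃ η : ℝ, 0 < η ∧
      (∀ t ∈ Set.Icc (1 : ℝ) (1 + η),
        2 * t * Real.log t ≤ P t ∧ P t ≤ f (t ^ 2 - 1)) ∧
      (∀ t ∈ Set.Icc (1 - η) (1 : ℝ),
        2 * t * Real.log t ≥ P t ∧ P t ≥ f (t ^ 2 - 1)) := by
  obtain ⟨η, hη, hη₁, h_mono⟩ := exists_monotoneOn_gap hε.2
  have h_one : (1 : ℝ) ∈ Icc (1 - η) (1 + η) := ⟨by linarith, by linarith⟩
  refine ⟨η, hη, fun t ht => ?_, fun t ht => ?_⟩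
  · have ht₀ : 0 < t := by linarith [ht.1]
    have h_gap := h_mono h_one ⟨h_one.1.trans ht.1, ht.2⟩ ht.1
    norm_num [Real.arctan_one] at h_gap
    have h_pow : 0 ≤ ε * (t - 1) ^ 5 := mul_nonneg hε.1.le (pow_nonneg (sub_nonneg.2 ht.1) 5)
    rw [hP t ht₀, f_sq_sub_one ht₀]
    constructor <;> linarith
  · have ht₀ : 0 < t := by linarith [ht.1]
    have h_gap := h_mono ⟨ht.1, ht.2.trans h_one.2⟩ h_one ht.2
    norm_num [Real.arctan_one] at h_gap
    have h_pow : ε * (t - 1) ^ 5 ≤ 0 :=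
      mul_nonpos_of_nonneg_of_nonpos hε.1.le
        (Odd.pow_nonpos (by decide) (sub_nonpos.2 ht.2))
    rw [hP t ht₀, f_sq_sub_one ht₀]
    constructor <;> linarith
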